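/- Let g ≥ 3 be an integer and let F : ℝ^{n+2} → ℝ be an isoparametric polynomial of degree g, i.e. the evaluation of a homogeneous polynomial of degree g satisfying ‖∇F(x)‖² = g²·‖x‖^{2g−2} and ΔF(x) = c·‖x‖^{g−2} for all x, for some constant c ∈ ℝ. Let k be an integer with 1 ≤ k ≤ g−2. Then for every p ∈ S^{n+1} with F(p) = cos(kπ/(g−1)), the gradient map Φ := (1/g)·∇F satisfies F(Φ(p)) = (−1)^k. That is, Φ maps the isoparametric hypersurface M_{cos(kπ/(g−1))} into a focal submanifold (M_1 if k is even, M_{−1} if k is odd). -/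

import Mathlib

open Real

/-- The Euclidean Laplacian of a function on a finite-dimensional real inner product space,
computed as the sum of second derivatives along an orthonormal basis. -/
noncomputable def laplacian {E : Type*} [NormedAddCommGroup E] [InnerProductSpace ℝ E]
    [FiniteDimensional ℝ E] (f : E → ℝ) (x : E) : ℝ :=
  ∑ i, iteratedFDeriv ℝ 2 f x ![stdOrthonormalBasis ℝ E i, stdOrthonormalBasis ℝ E i]

/-- The inverse Riesz isomorphism of a real Hilbert space, as a linear map. -/
noncomputable def toDualSymmCLM (E : Type*) [NormedAddCommGroup E] [InnerProductSpace ℝ E]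
    [CompleteSpace E] : StrongDual ℝ E →L[ℝ] E :=
  ((InnerProductSpace.toDual ℝ E).symm.toContinuousLinearEquiv : StrongDual ℝ E →L⋆[ℝ] E)

section Gradient

variable {E : Type*} [NormedAddCommGroup E] [InnerProductSpace ℝ E] [CompleteSpace E] {F : E → ℝ}

theorem ContDiff.contDiff_gradient (hF : ContDiff ℝ 2 F) : ContDiff ℝ 1 (gradient F) :=
  (toDualSymmCLM E).contDiff.comp (hF.fderiv_right (m := 1) (by norm_num))

theorem inner_fderiv_gradient_comm (hF : ContDiff ℝ 2 F) (x u v : E) :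
    inner ℝ (fderiv ℝ (gradient F) x u) v = inner ℝ (fderiv ℝ (gradient F) x v) u := by
  have hd : Differentiable ℝ (fderiv ℝ F) :=
    (hF.fderiv_right (m := 1) (by norm_num)).differentiable (by norm_num)
  have key : ∀ u v, inner ℝ (fderiv ℝ (gradient F) x u) v = fderiv ℝ (fderiv ℝ F) x u v := by
    intro u v
    have : fderiv ℝ (gradient F) x = (toDualSymmCLM E).comp (fderiv ℝ (fderiv ℝ F) x) :=
      ((toDualSymmCLM E).hasFDerivAt.comp x (hd x).hasFDerivAt).fderiv
    rw [this]
    simp [toDualSymmCLM]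
  rw [key, key]
  exact (hF.contDiffAt.isSymmSndFDerivAt (by simp)).eq u v

/-- The Hessian of a function satisfying Euler's identity, applied to the position vector. -/
theorem fderiv_gradient_self {g : ℝ} (hF : ContDiff ℝ 2 F)
    (hE : ∀ x, inner ℝ (gradient F x) x = g * F x) (x : E) :
    fderiv ℝ (gradient F) x x = (g - 1) • gradient F x := by
  refine ext_inner_right ℝ fun v => ?_
  have hd := hF.contDiff_gradient.differentiable (by norm_num) x
  have h1 := (hd.hasFDerivAt.inner ℝ (hasFDerivAt_id x)).fderiv
  have h2 := ((hF.differentiable (by norm_num) x).hasFDerivAt.const_mul g).fderiv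
  have h3 : (fun y => inner ℝ (gradient F y) (id y)) = fun y => g * F y := funext hE
  rw [h3, h2] at h1
  have h4 := congrArg (fun L => L v) h1
  simp [← inner_gradient_left] at h4
  rw [inner_fderiv_gradient_comm hF, inner_smul_left, conj_trivial]
  linarith

/-- The Hessian of a solution of the eikonal equation, applied to the gradient. -/
theorem fderiv_gradient_gradient {g : ℕ} (hg : 1 ≤ g) (hF : ContDiff ℝ 2 F)
    (hN : ∀ x, ‖gradient F x‖ ^ 2 = (g : ℝ) ^ 2 * ‖x‖ ^ (2 * g - 2)) {x : E} (hx : ‖x‖ = 1) :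
    fderiv ℝ (gradient F) x (gradient F x) = ((g : ℝ) ^ 2 * (g - 1)) • x := by
  refine ext_inner_right ℝ fun v => ?_
  have hd := hF.contDiff_gradient.differentiable (by norm_num) x
  have h1 := hd.hasFDerivAt.norm_sq.fderiv
  have h2 := (((hasFDerivAt_id x).norm_sq.pow (g - 1)).const_mul ((g : ℝ) ^ 2)).fderiv
  have h3 : (fun y => ‖gradient F y‖ ^ 2) = fun y => (g : ℝ) ^ 2 * (‖id y‖ ^ 2) ^ (g - 1) := by
    funext y
    rw [hN, ← pow_mul, Nat.mul_sub, mul_one, id]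
  rw [h3, h2] at h1
  have h4 := congrArg (fun L => L v) h1
  simp [hx, Nat.cast_sub hg] at h4
  rw [inner_fderiv_gradient_comm hF, inner_smul_left, real_inner_comm]
  simp
  linarith

end Gradient

/-- Along the great circle through `p` with initial direction `ν`, a vector field satisfying the
two differential identities of a gradient map is explicitly determined. -/
theorem eventually_eq_on_greatCircle {E : Type*} [NormedAddCommGroup E] [InnerProductSpace ℝ E]
    {Φ : E → E} {m θ : ℝ} (hC : ContDiff ℝ 1 Φ)
    (h1 : ∀ x, ‖x‖ = 1 → fderiv ℝ Φ x x = m • Φ x)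
    (h2 : ∀ x, ‖x‖ = 1 → fderiv ℝ Φ x (Φ x) = m • x)
    {p ν : E} (hp : ‖p‖ = 1) (hν : ‖ν‖ = 1) (hpν : inner ℝ p ν = 0)
    (hθ : sin θ ≠ 0) (hΦ : Φ p = cos θ • p + sin θ • ν) :
    ∀ᶠ s in nhds (0 : ℝ), Φ (cos s • p + sin s • ν) =
      cos (θ - (m + 1) * s) • (cos s • p + sin s • ν) +
        sin (θ - (m + 1) * s) • (-sin s • p + cos s • ν) := by
  set γ : ℝ → E := fun s => cos s • p + sin s • ν with hγ
  set γ' : ℝ → E := fun s => -sin s • p + cos s • ν with hγ'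
  set φ : ℝ → ℝ := fun s => θ - (m + 1) * s with hφ
  have dφ : ∀ s, HasDerivAt φ (-(m + 1)) s := fun s => by
    simpa using ((hasDerivAt_id s).const_mul (m + 1)).const_sub θ
  have dγ : ∀ s, HasDerivAt γ (γ' s) s := fun s =>
    ((hasDerivAt_cos s).smul_const p).add ((hasDerivAt_sin s).smul_const ν)
  have dγ' : ∀ s, HasDerivAt γ' (-γ s) s := fun s => by
    refine (((hasDerivAt_sin s).neg.smul_const p).add
      ((hasDerivAt_cos s).smul_const ν)).congr_deriv ?_
    simp only [hγ]
    module
  have nγ : ∀ s, ‖γ s‖ = 1 := fun s => by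
    rw [← sq_eq_sq₀ (norm_nonneg _) zero_le_one, norm_add_sq_real, norm_smul, norm_smul,
      inner_smul_left, inner_smul_right, hpν, hp, hν]
    simp
  have cγ : Continuous γ := by fun_prop
  have cφ : Continuous φ := by fun_prop
  set e : ℝ → E := fun s => Φ (γ s) - (cos (φ s) • γ s + sin (φ s) • γ' s) with he
  set L : ℝ → E →L[ℝ] E := fun s =>
    -(sin (φ s))⁻¹ • (fderiv ℝ Φ (γ s) + (m * cos (φ s)) • ContinuousLinearMap.id ℝ E) with hL
  have hφ0 : sin (φ 0) ≠ 0 := by simpa [hφ] using hθ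
  have cL : ContinuousAt L 0 := by
    have hc : Continuous (fderiv ℝ Φ) := hC.continuous_fderiv (by norm_num)
    have hc' : ContinuousAt (fun s => fderiv ℝ Φ (γ s) +
        (m * cos (φ s)) • ContinuousLinearMap.id ℝ E) 0 := by fun_prop
    have hi : ContinuousAt (fun s => -(sin (φ s))⁻¹) 0 :=
      (ContinuousAt.inv₀ (f := fun s => sin (φ s)) (by fun_prop) hφ0).neg
    exact hi.smul hc'
  have hsin : ∀ᶠ s in nhds (0 : ℝ), sin (φ s) ≠ 0 :=
    (continuous_sin.comp cφ).continuousAt.eventually_ne hφ0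
  have de : ∀ s, sin (φ s) ≠ 0 → HasDerivAt e (L s (e s)) s := fun s hs => by
    have d1 : HasDerivAt (fun s => Φ (γ s)) (fderiv ℝ Φ (γ s) (γ' s)) s :=
      ((hC.differentiable (by norm_num) (γ s)).hasFDerivAt).comp_hasDerivAt s (dγ s)
    have d2 := d1.sub (((dφ s).cos.smul (dγ s)).add ((dφ s).sin.smul (dγ' s)))
    refine d2.congr_deriv ?_
    have hA : sin (φ s) • fderiv ℝ Φ (γ s) (γ' s) =
        m • γ s - fderiv ℝ Φ (γ s) (e s) - (cos (φ s) * m) • Φ (γ s) := by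
      simp only [he, map_sub, map_add, map_smul, h1 _ (nγ s), h2 _ (nγ s)]
      module
    have hB : fderiv ℝ Φ (γ s) (γ' s) = (sin (φ s))⁻¹ •
        (m • γ s - fderiv ℝ Φ (γ s) (e s) - (cos (φ s) * m) • Φ (γ s)) := by
      rw [← hA, inv_smul_smul₀ hs]
    have hG : Φ (γ s) = e s + (cos (φ s) • γ s + sin (φ s) • γ' s) := by simp [he]
    rw [hB, hG]
    simp only [hL, smul_apply, add_apply,
      ContinuousLinearMap.id_apply]
    generalize fderiv ℝ Φ (γ s) (e s) = w, γ s = a, γ' s = b, e s = z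
    match_scalars
    all_goals field_simp
    · linear_combination -m * sin_sq_add_cos_sq (φ s)
    · ring
  have hz : e =ᶠ[nhds 0] fun _ => 0 := by
    refine ODE_solution_unique_of_eventually (v := fun s x => L s x) (s := fun _ => Set.univ)
      (K := ‖L 0‖₊ + 1) ?_ ?_ ?_ ?_
    · have hlt : ‖L 0‖₊ < ‖L 0‖₊ + 1 := by simp
      filter_upwards [cL.nnnorm.eventually_lt_const hlt] with s hs
      exact ((L s).lipschitz.weaken hs.le).lipschitzOnWith
    · filter_upwards [hsin] with s hs
      exact ⟨de s hs, trivial⟩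
    · filter_upwards with s
      simpa using hasDerivAt_const s (0 : E)
    · simp [he, hγ, hγ', hφ, hΦ]
  filter_upwards [hz] with s hs
  exact sub_eq_zero.mp hs

theorem MvPolynomial.IsHomogeneous.eval_smul {σ R : Type*} [CommSemiring R] {P : MvPolynomial σ R}
    {g : ℕ} (hP : P.IsHomogeneous g) (t : R) (x : σ → R) :
    MvPolynomial.eval (t • x) P = t ^ g * MvPolynomial.eval x P := by
  rw [MvPolynomial.eval_eq, MvPolynomial.eval_eq, Finset.mul_sum]
  refine Finset.sum_congr rfl fun d hd => ?_
  have hdeg : ∑ i ∈ d.support, d i = g := by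
    rw [← Finsupp.degree_apply, Finsupp.degree_eq_weight_one]
    exact hP (MvPolynomial.mem_support_iff.mp hd)
  simp only [Pi.smul_apply, smul_eq_mul, mul_pow, Finset.prod_mul_distrib,
    Finset.prod_pow_eq_pow_sum, hdeg]
  ring

/-- Euler's identity. -/
theorem inner_gradient_self_of_homogeneous {E : Type*} [NormedAddCommGroup E]
    [InnerProductSpace ℝ E] [CompleteSpace E] {F : E → ℝ} {g : ℕ} (hF : Differentiable ℝ F)
    (hh : ∀ (t : ℝ) x, F (t • x) = t ^ g * F x) (x : E) :
    inner ℝ (gradient F x) x = g * F x := by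
  have h1 : HasDerivAt (fun t : ℝ => F (t • x)) (fderiv ℝ F ((1 : ℝ) • x) ((1 : ℝ) • x)) 1 :=
    (hF _).hasFDerivAt.comp_hasDerivAt (1 : ℝ) ((hasDerivAt_id (1 : ℝ)).smul_const x)
  have h2 : HasDerivAt (fun t : ℝ => F (t • x)) (g * 1 ^ (g - 1) * F x) 1 := by
    simp_rw [hh]
    exact (hasDerivAt_pow g (1 : ℝ)).mul_const (F x)
  simpa [inner_gradient_left] using h1.unique h2

/-- An analytic solution of the eikonal equation `‖∇F‖² = g² ‖x‖^{2g-2}` satisfying Euler's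
identity oscillates along normal great circles; the gradient map follows them. -/
theorem apply_gradientMap_eq_cos {E : Type*} [NormedAddCommGroup E] [InnerProductSpace ℝ E]
    [CompleteSpace E] {F : E → ℝ} {g : ℕ} (hg : 1 ≤ g) (hF : AnalyticOnNhd ℝ F Set.univ)
    (hE : ∀ x, inner ℝ (gradient F x) x = g * F x)
    (hN : ∀ x, ‖gradient F x‖ ^ 2 = (g : ℝ) ^ 2 * ‖x‖ ^ (2 * g - 2))
    {p : E} (hp : ‖p‖ = 1) {θ : ℝ} (hθ : sin θ ≠ 0) (hFp : F p = cos θ) :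
    F ((g : ℝ)⁻¹ • gradient F p) = cos (θ - g * θ) := by
  have hg0 : (g : ℝ) ≠ 0 := by positivity
  have hF2 : ContDiff ℝ 2 F := hF.contDiff
  have hG := hF2.contDiff_gradient
  set Φ : E → E := fun x => (g : ℝ)⁻¹ • gradient F x with hΦ
  have hinner : ∀ x, inner ℝ (Φ x) x = F x := fun x => by
    simp [hΦ, inner_smul_left, hE, hg0]
  have hfd : ∀ x, fderiv ℝ Φ x = (g : ℝ)⁻¹ • fderiv ℝ (gradient F) x := fun x =>
    ((hG.differentiable (by norm_num) x).hasFDerivAt.const_smul (g : ℝ)⁻¹).fderiv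
  have hnorm : ‖Φ p‖ ^ 2 = 1 := by
    simp only [hΦ, norm_smul, mul_pow, hN, hp]
    simp [hg0]
  set ν : E := (sin θ)⁻¹ • (Φ p - cos θ • p) with hν
  have hpν : inner ℝ p ν = 0 := by
    rw [hν, inner_smul_right, inner_sub_right, real_inner_comm, hinner, hFp]
    simp [inner_smul_right, hp]
  have hνn : ‖ν‖ = 1 := by
    rw [← sq_eq_sq₀ (norm_nonneg _) zero_le_one, hν, norm_smul, mul_pow, norm_sub_sq_real, hnorm,
      norm_smul, inner_smul_right, hinner, hFp, hp]
    simp only [norm_inv, norm_eq_abs, inv_pow, sq_abs, mul_one, one_pow]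
    field_simp
    linear_combination -sin_sq_add_cos_sq θ
  have hΦp : Φ p = cos θ • p + sin θ • ν := by
    rw [hν, smul_inv_smul₀ hθ]
    abel
  have hev := eventually_eq_on_greatCircle (m := (g : ℝ) - 1) (hG.const_smul (g : ℝ)⁻¹)
    (fun x _ => by
      change fderiv ℝ Φ x x = _ • Φ x
      rw [hfd, smul_apply, fderiv_gradient_self hF2 hE]
      simp only [hΦ]
      module)
    (fun x hx => by
      change fderiv ℝ Φ x (Φ x) = _
      rw [hfd, smul_apply, map_smul, fderiv_gradient_gradient hg hF2 hN hx, smul_smul, smul_smul]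
      congr 1
      field_simp)
    hp hνn hpν hθ hΦp
  have heq : (fun s => F (cos s • p + sin s • ν)) =ᶠ[nhds 0] fun s => cos (θ - g * s) := by
    filter_upwards [hev] with s hs
    rw [← hinner]
    change Φ _ = _ at hs
    rw [hs]
    simp only [inner_add_left, inner_add_right, inner_smul_left, inner_smul_right, hpν,
      real_inner_comm p ν, real_inner_self_eq_norm_sq, hp, hνn]
    simp
    linear_combination cos (θ - g * s) * sin_sq_add_cos_sq s
  have hleft : AnalyticOnNhd ℝ (fun s => F (cos s • p + sin s • ν)) Set.univ := fun s _ =>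
    (hF _ trivial).comp (f := fun s : ℝ => cos s • p + sin s • ν) (by fun_prop)
  have hright : AnalyticOnNhd ℝ (fun s => cos (θ - g * s)) Set.univ := fun s _ => by fun_prop
  have := congrFun (hleft.eq_of_eventuallyEq hright heq) θ
  change F (Φ p) = _
  rw [hΦp]
  exact this

/-- Let `F` be an isoparametric polynomial of degree `g ≥ 3` (a homogeneous
polynomial of degree `g` with `‖∇F(x)‖² = g² ‖x‖^{2g-2}` and `ΔF(x) = c ‖x‖^{g-2}`), and let
`1 ≤ k ≤ g-2`.  Then for every `p` on the unit sphere with `F(p) = cos(kπ/(g-1))`, the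
gradient map `Φ = (1/g) ∇F` satisfies `F(Φ(p)) = (-1)^k`: the isoparametric hypersurface
`M_{cos(kπ/(g-1))}` is mapped into a focal submanifold (`M₁` if `k` is even, `M₋₁` if `k`
is odd). -/
theorem gradientMap_maps_hypersurface_to_focal (n g k : ℕ) (hg : 3 ≤ g)
    (hk1 : 1 ≤ k) (hk2 : k ≤ g - 2)
    (F : EuclideanSpace ℝ (Fin (n + 2)) → ℝ)
    (P : MvPolynomial (Fin (n + 2)) ℝ) (hP : P.IsHomogeneous g)
    (hFP : ∀ x, F x = MvPolynomial.eval x P)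
    (hCM1 : ∀ x, ‖gradient F x‖ ^ 2 = (g : ℝ) ^ 2 * ‖x‖ ^ (2 * g - 2))
    (c : ℝ) (hCM2 : ∀ x, laplacian F x = c * ‖x‖ ^ (g - 2))
    (Φ : EuclideanSpace ℝ (Fin (n + 2)) → EuclideanSpace ℝ (Fin (n + 2)))
    (hΦ : ∀ x, Φ x = (g : ℝ)⁻¹ • gradient F x) :
    ∀ p : EuclideanSpace ℝ (Fin (n + 2)), ‖p‖ = 1 →
      F p = Real.cos ((k : ℝ) * π / ((g : ℝ) - 1)) → F (Φ p) = (-1 : ℝ) ^ k := by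
  intro p hp hFp
  have hg' : (3 : ℝ) ≤ g := by exact_mod_cast hg
  have hk1' : (1 : ℝ) ≤ k := by exact_mod_cast hk1
  have hk2' : (k : ℝ) + 2 ≤ g := by
    have : k + 2 ≤ g := by omega
    exact_mod_cast this
  have hF : AnalyticOnNhd ℝ F Set.univ := by
    have h := AnalyticOnNhd.aeval_mvPolynomial (s := Set.univ)
      (fun i => (EuclideanSpace.proj i : EuclideanSpace ℝ (Fin (n + 2)) →L[ℝ] ℝ).analyticOnNhd _) P
    rw [funext hFP]
    exact h
  have hh : ∀ (t : ℝ) x, F (t • x) = t ^ g * F x := fun t x => by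
    rw [hFP, hFP]
    exact hP.eval_smul t x
  have hθ : 0 < sin ((k : ℝ) * π / ((g : ℝ) - 1)) := by
    refine sin_pos_of_pos_of_lt_pi (div_pos (by positivity) (by linarith)) ?_
    rw [div_lt_iff₀ (by linarith)]
    nlinarith [pi_pos]
  rw [hΦ, apply_gradientMap_eq_cos (by omega) hF
    (inner_gradient_self_of_homogeneous (hF.contDiff (n := 1).differentiable (by norm_num)) hh)
    hCM1 hp hθ.ne' hFp, ← cos_nat_mul_pi, ← cos_neg]
  congr 1
  have : (g : ℝ) - 1 ≠ 0 := by linarith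
  field_simp
  ring
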